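/- Let c ≥ 1 and for every n ∈ ℕ let μ_n and μ'_n be the probability measures on ℂⁿ whose densities with respect to Lebesgue measure are proportional to, respectively, (∏_{i=1}^n |z_i|)^{2(c−1)n} · (∏_{1≤i<j≤n} |z_i − z_j|²) · exp(−n Σ_{i=1}^n |z_i|²) and (∏_{i=1}^n |z_i|)^{2(c−1)n} · (Σ_{π∈S_n} ∏_{i=1}^n |z_i|^{2(π(i)−1)}) · exp(−n Σ_{i=1}^n |z_i|²). For p ∈ {1,…,n} let μ_n^{(p)} and (μ'_n)^{(p)} denote the marginals on the first p coordinates. Then for every p, (μ'_n)^{(p)} is obtained from μ_n^{(p)} by averaging over the action of the p-torus 𝕋^p on ℂ^p by coordinatewise multiplication ((w₁,…,w_p),(z₁,…,z_p)) ↦ (w₁z₁,…,w_pz_p). Consequently, (μ'_n)^{(p)} converges as n → ∞, in *-moments and in the weak* topology, to ρ^{⊗p}, where ρ is the uniform distribution on the annulus {z ∈ ℂ : √(c−1) < |z| < √c}. -/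

import Mathlib

open MeasureTheory Filter

/-- The uniform probability distribution on the annulus `{z : √(c-1) < |z| < √c}` in `ℂ`. -/
noncomputable def annulusUniform (c : ℝ) : Measure ℂ :=
  (volume {z : ℂ | Real.sqrt (c - 1) < ‖z‖ ∧ ‖z‖ < Real.sqrt c})⁻¹ •
    volume.restrict {z : ℂ | Real.sqrt (c - 1) < ‖z‖ ∧ ‖z‖ < Real.sqrt c}

/-- Normalized Haar measure on the `p`-torus, parametrized by angles in `[0, 2π)^p`. -/
noncomputable def torusHaar (p : ℕ) : Measure (Fin p → ℝ) :=
  Measure.pi (fun _ : Fin p =>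
    (volume (Set.Ico (0 : ℝ) (2 * Real.pi)))⁻¹ • volume.restrict (Set.Ico 0 (2 * Real.pi)))

/-- The average of a measure on `ℂ^p` over the action of the `p`-torus by coordinatewise
multiplication: the pushforward of `Haar ⊗ μ` under `(θ, z) ↦ (e^{iθ₁}z₁, …, e^{iθ_p}z_p)`. -/
noncomputable def torusAverage (p : ℕ) (μ : Measure (Fin p → ℂ)) : Measure (Fin p → ℂ) :=
  Measure.map (fun q : (Fin p → ℝ) × (Fin p → ℂ) =>
    fun j => Complex.exp (Complex.I * (q.1 j : ℂ)) * q.2 j) ((torusHaar p).prod μ)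

/-- The algebra of polynomials in the coordinates and their conjugates, as functions on `ℂ^p`. -/
noncomputable def starPolynomials (p : ℕ) : Subalgebra ℂ ((Fin p → ℂ) → ℂ) :=
  Algebra.adjoin ℂ (Set.range (fun (j : Fin p) (x : Fin p → ℂ) => x j) ∪
    Set.range (fun (j : Fin p) (x : Fin p → ℂ) => (starRingEnd ℂ) (x j)))

lemma mem_starPolynomials_coord {p : ℕ} (j : Fin p) :
    (fun x : Fin p → ℂ => x j) ∈ starPolynomials p :=
  Algebra.subset_adjoin (Or.inl ⟨j, rfl⟩)

lemma mem_starPolynomials_conj {p : ℕ} (j : Fin p) :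
    (fun x : Fin p → ℂ => (starRingEnd ℂ) (x j)) ∈ starPolynomials p :=
  Algebra.subset_adjoin (Or.inr ⟨j, rfl⟩)

/-- Every *-polynomial is a linear combination of *-monomials. -/
lemma starPolynomials_induction {p : ℕ} {P : ((Fin p → ℂ) → ℂ) → Prop}
    (mono : ∀ k ℓ : Fin p → ℕ, P fun x => ∏ j, x j ^ k j * (starRingEnd ℂ) (x j) ^ ℓ j)
    (hzero : P 0) (hadd : ∀ f g, P f → P g → P (f + g)) (hsmul : ∀ (a : ℂ) f, P f → P (a • f))
    {g : (Fin p → ℂ) → ℂ} (hg : g ∈ starPolynomials p) : P g := by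
  have hg' : g ∈ Submodule.span ℂ (SetLike.coe (Submonoid.closure
      (Set.range (fun (j : Fin p) (x : Fin p → ℂ) => x j) ∪
        Set.range (fun (j : Fin p) (x : Fin p → ℂ) => (starRingEnd ℂ) (x j))))) := by
    rw [← Algebra.adjoin_eq_span]; exact hg
  refine Submodule.span_induction (p := fun g _ => P g) ?_ hzero
    (fun f g _ _ => hadd f g) (fun a f _ => hsmul a f) hg'
  intro f hf
  suffices ∃ k ℓ : Fin p → ℕ, f = fun x => ∏ j, x j ^ k j * (starRingEnd ℂ) (x j) ^ ℓ j by
    obtain ⟨k, ℓ, rfl⟩ := this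
    exact mono k ℓ
  refine Submonoid.closure_induction (motive := fun f _ => ∃ k ℓ : Fin p → ℕ,
    f = fun x => ∏ j, x j ^ k j * (starRingEnd ℂ) (x j) ^ ℓ j) ?_ ?_ ?_ hf
  · rintro _ (⟨i, rfl⟩ | ⟨i, rfl⟩)
    · refine ⟨Pi.single i 1, 0, ?_⟩
      ext x
      simp [Pi.single_apply, Finset.prod_ite_eq', pow_ite]
    · refine ⟨0, Pi.single i 1, ?_⟩
      ext x
      simp [Pi.single_apply, Finset.prod_ite_eq', pow_ite]
  · exact ⟨0, 0, by ext x; simp⟩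
  · rintro _ _ _ _ ⟨k, ℓ, rfl⟩ ⟨k', ℓ', rfl⟩
    refine ⟨k + k', ℓ + ℓ', ?_⟩
    ext x
    simp only [Pi.mul_apply, ← Finset.prod_mul_distrib, Pi.add_apply, pow_add]
    exact Finset.prod_congr rfl fun j _ => by ring

/-- The real-valued *-polynomials. -/
noncomputable def realStarPolynomials (p : ℕ) : Subalgebra ℝ C(Fin p → ℂ, ℝ) where
  carrier := {f | (fun x => (f x : ℂ)) ∈ starPolynomials p}
  mul_mem' {f g} hf hg := by
    simpa [Pi.mul_def] using (starPolynomials p).mul_mem hf hg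
  add_mem' {f g} hf hg := by
    simpa [Pi.add_def] using (starPolynomials p).add_mem hf hg
  algebraMap_mem' r := by
    exact (starPolynomials p).algebraMap_mem (r : ℂ)

lemma mem_realStarPolynomials {p : ℕ} {f : C(Fin p → ℂ, ℝ)} :
    f ∈ realStarPolynomials p ↔ (fun x => (f x : ℂ)) ∈ starPolynomials p := Iff.rfl

lemma realStarPolynomials_separatesPoints (p : ℕ) : (realStarPolynomials p).SeparatesPoints := by
  intro x y hxy
  obtain ⟨j, hj⟩ := Function.ne_iff.mp hxy
  by_cases h : (x j).re = (y j).re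
  · refine ⟨fun x => (x j).im, ⟨⟨fun x => (x j).im, by fun_prop⟩, ?_, rfl⟩,
      fun h' => hj (Complex.ext h h')⟩
    refine mem_realStarPolynomials.2 ?_
    convert (starPolynomials p).smul_mem
      ((starPolynomials p).sub_mem (mem_starPolynomials_coord j) (mem_starPolynomials_conj j))
      (2 * Complex.I)⁻¹ using 1
    ext x
    simp [Complex.sub_conj]
    field_simp
    simp
  · refine ⟨fun x => (x j).re, ⟨⟨fun x => (x j).re, by fun_prop⟩, ?_, rfl⟩, h⟩
    refine mem_realStarPolynomials.2 ?_
    convert (starPolynomials p).smul_mem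
      ((starPolynomials p).add_mem (mem_starPolynomials_coord j) (mem_starPolynomials_conj j))
      (2 : ℂ)⁻¹ using 1
    ext x
    simp [Complex.add_conj]

lemma normSq_mem_realStarPolynomials {p : ℕ} (j : Fin p) :
    (⟨fun x => ‖x j‖ ^ 2, by fun_prop⟩ : C(Fin p → ℂ, ℝ)) ∈ realStarPolynomials p := by
  refine mem_realStarPolynomials.2 ?_
  convert (starPolynomials p).mul_mem (mem_starPolynomials_coord j)
    (mem_starPolynomials_conj j) using 1
  ext x
  simp [Complex.mul_conj, Complex.normSq_eq_norm_sq]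

/-- Convergence in *-moments to a compactly supported limit implies convergence of the integrals
of bounded continuous functions. -/
lemma tendsto_integral_of_tendsto_moments {p : ℕ} (ν : ℕ → Measure (Fin p → ℂ))
    (ρ : Measure (Fin p → ℂ)) [∀ n, IsProbabilityMeasure (ν n)] [IsProbabilityMeasure ρ]
    {R : ℝ} (hR : 0 ≤ R) (hρ : ∀ᵐ x ∂ρ, ‖x‖ ≤ R)
    (hν : ∀ n, ∀ k ℓ : Fin p → ℕ,
      Integrable (fun x => ∏ j, x j ^ k j * (starRingEnd ℂ) (x j) ^ ℓ j) (ν n))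
    (hlim : ∀ k ℓ : Fin p → ℕ,
      Tendsto (fun n => ∫ x, (∏ j, x j ^ k j * (starRingEnd ℂ) (x j) ^ ℓ j) ∂(ν n)) atTop
        (nhds (∫ x, (∏ j, x j ^ k j * (starRingEnd ℂ) (x j) ^ ℓ j) ∂ρ)))
    (f : C(Fin p → ℂ, ℝ)) {M : ℝ} (hM : ∀ x, |f x| ≤ M) :
    Tendsto (fun n => ∫ x, f x ∂(ν n)) atTop (nhds (∫ x, f x ∂ρ)) := by
  have hM0 : 0 ≤ M := (abs_nonneg _).trans (hM 0)
  have intρ (g : C(Fin p → ℂ, ℝ)) : Integrable g ρ := by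
    obtain ⟨C, hC⟩ := (isCompact_closedBall (0 : Fin p → ℂ) R).exists_bound_of_continuousOn
      g.continuous.continuousOn
    refine Integrable.of_bound g.continuous.aestronglyMeasurable C ?_
    filter_upwards [hρ] with x hx
    exact hC x (by simpa using hx)
  have hpoly (g : (Fin p → ℂ) → ℂ) (hg : g ∈ starPolynomials p) :
      (∀ n, Integrable g (ν n)) ∧ Integrable g ρ ∧
        Tendsto (fun n => ∫ x, g x ∂(ν n)) atTop (nhds (∫ x, g x ∂ρ)) := by
    refine starPolynomials_induction (P := fun g => (∀ n, Integrable g (ν n)) ∧ Integrable g ρ ∧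
      Tendsto (fun n => ∫ x, g x ∂(ν n)) atTop (nhds (∫ x, g x ∂ρ)))
      (fun k ℓ => ⟨fun n => hν n k ℓ, ?_, hlim k ℓ⟩) ?_ ?_ ?_ hg
    · obtain ⟨C, hC⟩ := (isCompact_closedBall (0 : Fin p → ℂ) R).exists_bound_of_continuousOn
        (f := fun x : Fin p → ℂ => ∏ j, x j ^ k j * (starRingEnd ℂ) (x j) ^ ℓ j)
        (Continuous.continuousOn (by fun_prop))
      refine Integrable.of_bound (Continuous.aestronglyMeasurable (by fun_prop)) C ?_
      filter_upwards [hρ] with x hx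
      exact hC x (by simpa using hx)
    · exact ⟨fun n => integrable_zero _ _ _, integrable_zero _ _ _, by simp⟩
    · rintro g h ⟨g1, g2, g3⟩ ⟨h1, h2, h3⟩
      refine ⟨fun n => (g1 n).add (h1 n), g2.add h2, ?_⟩
      simp only [Pi.add_apply]
      rw [integral_add g2 h2]
      refine (g3.add h3).congr fun n => ?_
      rw [integral_add (g1 n) (h1 n)]
    · rintro a g ⟨g1, g2, g3⟩
      refine ⟨fun n => (g1 n).smul a, g2.smul a, ?_⟩
      simp only [Pi.smul_apply, integral_smul]
      exact g3.const_smul a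
  have hreal (g : C(Fin p → ℂ, ℝ)) (hg : g ∈ realStarPolynomials p) :
      (∀ n, Integrable g (ν n)) ∧
        Tendsto (fun n => ∫ x, g x ∂(ν n)) atTop (nhds (∫ x, g x ∂ρ)) := by
    obtain ⟨h1, h2, h3⟩ := hpoly _ hg
    refine ⟨fun n => by simpa using (h1 n).re, ?_⟩
    have h4 := (Complex.continuous_re.tendsto _).comp h3
    simp only [Function.comp_def, integral_complex_ofReal, Complex.ofReal_re] at h4
    exact h4
  rw [Metric.tendsto_atTop']
  suffices ∀ ε > 0, ∀ᶠ n in atTop, dist (∫ x, f x ∂(ν n)) (∫ x, f x ∂ρ) < 5 * ε by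
    intro ε hε
    obtain ⟨N, hN⟩ := eventually_atTop.1 (this (ε / 5) (by positivity))
    exact ⟨N, fun n hn => by simpa [mul_div_cancel₀] using hN n hn.le⟩
  intro ε hε
  obtain ⟨g, hg, hgf⟩ :=
    ContinuousMap.exists_mem_subalgebra_near_continuous_of_isCompact_of_separatesPoints
      (realStarPolynomials_separatesPoints p) f
      (isCompact_closedBall (0 : Fin p → ℂ) (R + 1)) hε
  have hR1 : 0 < R + 1 := by positivity
  let q (j : Fin p) : C(Fin p → ℂ, ℝ) := ⟨fun x => ‖x j‖ ^ 2, by fun_prop⟩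
  let H (m : ℕ) : C(Fin p → ℂ, ℝ) := algebraMap ℝ _ ε +
    (algebraMap ℝ _ (M + 1) + g * g) * ∑ j, (((R + 1) ^ 2)⁻¹ • q j) ^ m
  have hH (m : ℕ) : H m ∈ realStarPolynomials p := by
    refine add_mem (algebraMap_mem _ _) (mul_mem (add_mem (algebraMap_mem _ _) (mul_mem hg hg))
      (sum_mem fun j _ => pow_mem (Subalgebra.smul_mem _ ?_ _) m))
    exact normSq_mem_realStarPolynomials j
  have Hx (m : ℕ) (x) : H m x =
      ε + (M + 1 + g x * g x) * ∑ j, (((R + 1) ^ 2)⁻¹ * ‖x j‖ ^ 2) ^ m := by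
    simp [H, q]
  have Hle (m : ℕ) (x) : |f x - g x| ≤ H m x := by
    rw [Hx]
    have hQ : 0 < M + 1 + g x * g x := by nlinarith [mul_self_nonneg (g x)]
    by_cases hx : ‖x‖ ≤ R + 1
    · have h1 := hgf x (by simpa using hx)
      rw [Real.norm_eq_abs, abs_sub_comm] at h1
      have : 0 ≤ ∑ j, (((R + 1) ^ 2)⁻¹ * ‖x j‖ ^ 2) ^ m :=
        Finset.sum_nonneg fun j _ => by positivity
      nlinarith [mul_nonneg hQ.le this]
    · rw [pi_norm_le_iff_of_nonneg hR1.le] at hx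
      push Not at hx
      obtain ⟨i, hi⟩ := hx
      have h1 : 1 ≤ ∑ j, (((R + 1) ^ 2)⁻¹ * ‖x j‖ ^ 2) ^ m := by
        refine le_trans (one_le_pow₀ ?_ (n := m)) (Finset.single_le_sum
          (f := fun j => (((R + 1) ^ 2)⁻¹ * ‖x j‖ ^ 2) ^ m) (fun j _ => by positivity)
          (Finset.mem_univ i))
        rw [inv_mul_eq_div, one_le_div (by positivity)]
        gcongr
      have h2 : |f x - g x| ≤ M + |g x| := (abs_sub _ _).trans (by gcongr; exact hM x)
      have h3 : |g x| ≤ 1 + g x * g x := by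
        rw [← abs_mul_abs_self (g x)]; nlinarith [mul_self_nonneg (|g x| - 1)]
      nlinarith [mul_le_mul_of_nonneg_left h1 hQ.le]
  obtain ⟨m, hm⟩ : ∃ m, ∫ x, H m x ∂ρ < 2 * ε := by
    have key (m : ℕ) : ∫ x, H m x ∂ρ ≤
        ε + (M + 1 + (M + ε) ^ 2) * (p * (((R + 1) ^ 2)⁻¹ * R ^ 2) ^ m) := by
      have : ∫ x, H m x ∂ρ ≤
          ∫ x, (ε + (M + 1 + (M + ε) ^ 2) * (p * (((R + 1) ^ 2)⁻¹ * R ^ 2) ^ m)) ∂ρ := by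
        refine integral_mono_ae (intρ _) (integrable_const _) ?_
        filter_upwards [hρ] with x hx
        rw [Hx]
        have h1 := hgf x (by simp; linarith)
        have h2 : |g x| ≤ M + ε := by
          have := abs_add_le (g x - f x) (f x)
          rw [Real.norm_eq_abs] at h1
          simp only [sub_add_cancel] at this
          linarith [hM x]
        have h3 : g x * g x ≤ (M + ε) ^ 2 := by
          rw [← abs_mul_abs_self, ← sq]; gcongr
        have h4 : ∑ j, (((R + 1) ^ 2)⁻¹ * ‖x j‖ ^ 2) ^ m ≤
            p * (((R + 1) ^ 2)⁻¹ * R ^ 2) ^ m := by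
          refine (Finset.sum_le_card_nsmul _ _ ((((R + 1) ^ 2)⁻¹ * R ^ 2) ^ m)
            fun j _ => ?_).trans (by simp)
          have := (norm_le_pi_norm x j).trans hx
          gcongr
        gcongr
      simpa using this
    have hr : ((R + 1) ^ 2)⁻¹ * R ^ 2 < 1 := by
      rw [inv_mul_eq_div, div_lt_one (by positivity)]
      nlinarith
    have ht := (((tendsto_pow_atTop_nhds_zero_of_lt_one (by positivity) hr).const_mul
      (p : ℝ)).const_mul (M + 1 + (M + ε) ^ 2)).const_add ε
    simp only [mul_zero, add_zero] at ht
    obtain ⟨m, hm⟩ := (ht.eventually_lt_const (show ε < 2 * ε by linarith)).exists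
    exact ⟨m, (key m).trans_lt hm⟩
  have bound (ν : Measure (Fin p → ℂ)) [IsProbabilityMeasure ν] (h1 : Integrable g ν)
      (h2 : Integrable (H m) ν) : |∫ x, f x ∂ν - ∫ x, g x ∂ν| ≤ ∫ x, H m x ∂ν := by
    have hf : Integrable f ν := Integrable.of_bound f.continuous.aestronglyMeasurable M
      (Eventually.of_forall hM)
    rw [← integral_sub hf h1]
    exact abs_integral_le_integral_abs.trans (integral_mono (hf.sub h1).abs h2 (Hle m))
  filter_upwards [(hreal _ (hH m)).2.eventually_lt_const hm,
    (Metric.tendsto_nhds.1 (hreal g hg).2) ε hε] with n h1 h2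
  have b1 := bound (ν n) ((hreal g hg).1 n) ((hreal _ (hH m)).1 n)
  have b2 := bound ρ (intρ _) (intρ _)
  rw [Real.dist_eq] at h2 ⊢
  rw [abs_lt] at *
  rw [abs_le] at *
  constructor <;> linarith

open scoped Nat in
/-- Averaging over permutations a function of the first `p` values is the same as averaging over
embeddings. -/
lemma sum_perm_eq_sum_embedding {p n : ℕ} (ι : Fin p ↪ Fin n) (F : (Fin p ↪ Fin n) → ℝ) :
    ((n ! : ℝ))⁻¹ * ∑ π : Equiv.Perm (Fin n), F (ι.trans π.toEmbedding) =
      ((n.descFactorial p : ℕ) : ℝ)⁻¹ * ∑ e : Fin p ↪ Fin n, F e := by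
  classical
  let N (e : Fin p ↪ Fin n) : ℕ :=
    (Finset.univ.filter fun π : Equiv.Perm (Fin n) => ι.trans π.toEmbedding = e).card
  have hN (e e' : Fin p ↪ Fin n) : N e = N e' := by
    obtain ⟨σ, hσ⟩ := Equiv.Perm.exists_smul_eq_embedding e e'
    have hσ' (j) : σ (e j) = e' j := DFunLike.congr_fun hσ j
    refine Finset.card_bij' (fun π _ => σ * π) (fun π _ => σ⁻¹ * π) ?_ ?_ ?_ ?_
    · simp only [Finset.mem_filter, Finset.mem_univ, true_and]
      rintro π rfl
      ext j
      simp [← hσ']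
    · simp only [Finset.mem_filter, Finset.mem_univ, true_and]
      rintro π rfl
      ext j
      have := hσ' j
      simp at this
      simp [← this]
    · simp
    · simp
  have hF (G : (Fin p ↪ Fin n) → ℝ) : ∑ π : Equiv.Perm (Fin n), G (ι.trans π.toEmbedding) =
      N ι * ∑ e : Fin p ↪ Fin n, G e := by
    rw [← Finset.sum_fiberwise (s := Finset.univ) (g := fun π => ι.trans π.toEmbedding),
      Finset.mul_sum]
    refine Finset.sum_congr rfl fun e _ => ?_
    rw [Finset.sum_congr rfl (g := fun _ => G e)
      (fun π hπ => by rw [(Finset.mem_filter.1 hπ).2])]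
    rw [Finset.sum_const, nsmul_eq_mul, ← hN e]
  have h1 := hF fun _ => 1
  simp only [Finset.sum_const, Finset.card_univ, Fintype.card_perm, Fintype.card_embedding_eq,
    Fintype.card_fin, nsmul_eq_mul, mul_one] at h1
  have h0 : (n ! : ℝ) ≠ 0 := by positivity
  have hN0 : (N ι : ℝ) ≠ 0 := fun h => h0 (by rw [h1, h, zero_mul])
  have hd : ((n.descFactorial p : ℕ) : ℝ) ≠ 0 := fun h => h0 (by rw [h1, h, mul_zero])
  rw [hF, h1]
  field_simp

lemma tendsto_descFactorial_div_pow (p : ℕ) :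
    Tendsto (fun n : ℕ => ((n.descFactorial p : ℕ) : ℝ) / (n : ℝ) ^ p) atTop (nhds 1) := by
  induction p with
  | zero => simp
  | succ p ih =>
    have h : Tendsto (fun n : ℕ => 1 - (p : ℝ) / n) atTop (nhds 1) := by
      simpa using (tendsto_const_div_atTop_nhds_zero_nat (p : ℝ)).const_sub 1
    refine (by simpa using h.mul ih : Tendsto _ _ _).congr' ?_
    filter_upwards [eventually_ge_atTop (p + 1)] with n hn
    have : (n : ℝ) ≠ 0 := Nat.cast_ne_zero.2 (by omega)
    rw [Nat.descFactorial_succ, Nat.cast_mul, Nat.cast_sub (by omega)]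
    field_simp
    ring

open scoped Nat in
/-- Asymptotic independence of the values of a uniformly random permutation at finitely many
points. -/
lemma tendsto_perm_average {p : ℕ} (a : ∀ n : ℕ, Fin p → Fin n → ℝ) {C : ℝ}
    (ha : ∀ n j i, |a n j i| ≤ C) (L : Fin p → ℝ)
    (hL : ∀ j, Tendsto (fun n : ℕ => (n : ℝ)⁻¹ * ∑ i, a n j i) atTop (nhds (L j))) :
    Tendsto (fun n : ℕ => if h : p ≤ n then ((n ! : ℝ))⁻¹ *
      ∑ π : Equiv.Perm (Fin n), ∏ j, a n j (π (Fin.castLE h j)) else 0) atTop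
      (nhds (∏ j, L j)) := by
  classical
  have hall : Tendsto (fun n : ℕ => ((n : ℝ) ^ p)⁻¹ * ∑ e : Fin p → Fin n, ∏ j, a n j (e j))
      atTop (nhds (∏ j, L j)) := by
    refine (tendsto_finsetProd Finset.univ fun j _ => hL j).congr fun n => ?_
    rw [Finset.prod_mul_distrib, Fintype.prod_sum]
    simp
  have hinj (n : ℕ) (F : (Fin p → Fin n) → ℝ) : ∑ e : Fin p ↪ Fin n, F e =
      ∑ e ∈ Finset.univ.filter (fun e : Fin p → Fin n => Function.Injective e), F e := by
    refine Finset.sum_bij (fun e _ => e) (by simp [Function.Embedding.injective])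
      (fun e _ e' _ h => DFunLike.coe_injective h)
      (fun e he => ⟨⟨e, (Finset.mem_filter.1 he).2⟩, Finset.mem_univ _, rfl⟩) (fun _ _ => rfl)
  have hd := tendsto_descFactorial_div_pow p
  have hdiff : Tendsto (fun n : ℕ => ((n : ℝ) ^ p)⁻¹ * ∑ e : Fin p ↪ Fin n, ∏ j, a n j (e j))
      atTop (nhds (∏ j, L j)) := by
    have hz : Tendsto (fun n : ℕ => ((n : ℝ) ^ p)⁻¹ * ∑ e : Fin p → Fin n, ∏ j, a n j (e j) -
        ((n : ℝ) ^ p)⁻¹ * ∑ e : Fin p ↪ Fin n, ∏ j, a n j (e j)) atTop (nhds 0) := by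
      refine squeeze_zero_norm' (a := fun n : ℕ =>
        C ^ p * (1 - ((n.descFactorial p : ℕ) : ℝ) / (n : ℝ) ^ p)) ?_
        (by simpa using (hd.const_sub 1).const_mul (C ^ p))
      filter_upwards [eventually_ge_atTop 1] with n hn
      have hn0 : (0 : ℝ) < n := by positivity
      have hcard := hinj n fun _ => 1
      have hsplit := Finset.sum_filter_add_sum_filter_not Finset.univ
        (fun e : Fin p → Fin n => Function.Injective e) (fun e => ∏ j, a n j (e j))
      have hsplit1 := Finset.sum_filter_add_sum_filter_not Finset.univ
        (fun e : Fin p → Fin n => Function.Injective e) (fun e => (1 : ℝ))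
      rw [hinj n (fun e => ∏ j, a n j (e j)), ← mul_sub, ← hsplit, add_sub_cancel_left, norm_mul]
      have hb : ‖∑ e ∈ Finset.univ.filter (fun e : Fin p → Fin n => ¬ Function.Injective e),
          ∏ j, a n j (e j)‖ ≤ C ^ p * ((n : ℝ) ^ p - ((n.descFactorial p : ℕ) : ℝ)) := by
        rw [← hcard] at hsplit1
        simp only [Finset.sum_const, Finset.card_univ, Fintype.card_embedding_eq,
          Fintype.card_fin, nsmul_eq_mul, mul_one, Fintype.card_fun, Nat.cast_pow] at hsplit1
        rw [← hsplit1, add_sub_cancel_left, mul_comm (C ^ p), ← nsmul_eq_mul]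
        refine (norm_sum_le _ _).trans (Finset.sum_le_card_nsmul _ _ _ fun e _ => ?_)
        rw [norm_prod]
        exact (Finset.prod_le_prod (fun _ _ => norm_nonneg _) fun j _ => ha n j (e j)).trans
          (by simp)
      rw [norm_inv, norm_pow, Real.norm_natCast]
      calc _ ≤ ((n : ℝ) ^ p)⁻¹ * (C ^ p * ((n : ℝ) ^ p - ((n.descFactorial p : ℕ) : ℝ))) := by
            gcongr
        _ = _ := by field_simp
    simpa using hall.sub hz
  refine (by simpa using hdiff.div hd one_ne_zero : Tendsto _ _ _).congr' ?_
  filter_upwards [eventually_ge_atTop (p + 1)] with n hn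
  have hpn : p ≤ n := by omega
  have hn0 : (n : ℝ) ≠ 0 := Nat.cast_ne_zero.2 (by omega)
  rw [dif_pos hpn]
  refine Eq.trans ?_ (sum_perm_eq_sum_embedding (Fin.castLEEmb hpn)
    fun e => ∏ j, a n j (e j)).symm
  have : ((n.descFactorial p : ℕ) : ℝ) ≠ 0 := by
    rw [Nat.cast_ne_zero, Ne, Nat.descFactorial_eq_zero_iff_lt]; omega
  simp only [Pi.div_apply]
  field_simp

/-- The telescoping sum of rising factorials. -/
lemma sum_prod_add_eq (x : ℝ) (k n : ℕ) :
    (k + 1) * ∑ i ∈ Finset.range n, ∏ m ∈ Finset.range k, (x + i + (m + 1)) =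
      ∏ m ∈ Finset.range (k + 1), (x + n + m) - ∏ m ∈ Finset.range (k + 1), (x + m) := by
  induction n with
  | zero => simp
  | succ n ih =>
    rw [Finset.sum_range_succ, mul_add, ih, Finset.prod_range_succ' (fun m : ℕ => x + n + m),
      Finset.prod_range_succ (fun m : ℕ => x + (n + 1 : ℕ) + m)]
    have : ∏ m ∈ Finset.range k, (x + (n + 1 : ℕ) + m) =
        ∏ m ∈ Finset.range k, (x + n + (m + 1)) :=
      Finset.prod_congr rfl fun m _ => by push_cast; ring
    rw [this]
    push_cast
    ring

lemma tendsto_average_moment (c : ℝ) (k : ℕ) :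
    Tendsto (fun n : ℕ => (n : ℝ)⁻¹ * ∑ i : Fin n,
      ∏ m ∈ Finset.range k, (((c - 1) * n + i + (m + 1)) / n)) atTop
      (nhds ((c ^ (k + 1) - (c - 1) ^ (k + 1)) / (k + 1))) := by
  have h (b : ℝ) : Tendsto (fun n : ℕ => ∏ m ∈ Finset.range (k + 1), (b + (m : ℝ) / n)) atTop
      (nhds (b ^ (k + 1))) := by
    have := tendsto_finsetProd (Finset.range (k + 1)) fun m _ =>
      (tendsto_const_div_atTop_nhds_zero_nat (m : ℝ)).const_add b
    simpa using this
  refine (((h c).sub (h (c - 1))).div_const ((k : ℝ) + 1)).congr' ?_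
  filter_upwards [eventually_ge_atTop 1] with n hn
  have hn0 : (n : ℝ) ≠ 0 := by positivity
  have hk : (k : ℝ) + 1 ≠ 0 := by positivity
  rw [Fin.sum_univ_eq_sum_range
    (fun i => ∏ m ∈ Finset.range k, (((c - 1) * n + i + (m + 1)) / (n : ℝ)))]
  have hs := sum_prod_add_eq ((c - 1) * n) k n
  have e (b : ℝ) : ∏ m ∈ Finset.range (k + 1), (b + (m : ℝ) / n) =
      (∏ m ∈ Finset.range (k + 1), (b * n + m)) / (n : ℝ) ^ (k + 1) := by
    rw [← Finset.card_range (k + 1), ← Finset.prod_const, Finset.card_range,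
      ← Finset.prod_div_distrib]
    exact Finset.prod_congr rfl fun m _ => by field_simp
  have hc : (c - 1) * n + n = c * n := by ring
  rw [hc] at hs
  rw [e, e, ← sub_div, ← hs]
  simp only [Finset.prod_div_distrib, Finset.prod_const, Finset.card_range, ← Finset.sum_div]
  field_simp
  ring

/-- The `i`-th one-particle weight `|z|^{2a} |z|^{2i} exp(-b|z|²)`. -/
noncomputable def siteWeight (a b : ℝ) (i : ℕ) (z : ℂ) : ℝ :=
  ‖z‖ ^ (2 * a) * ‖z‖ ^ (2 * i) * Real.exp (-b * ‖z‖ ^ 2)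

lemma integrable_rpow_mul_exp_neg {b s : ℝ} (hb : 0 < b) (hs : 0 ≤ s) :
    Integrable fun z : ℂ => ‖z‖ ^ s * Real.exp (-b * ‖z‖ ^ (2 : ℝ)) := by
  refine Integrable.of_integral_ne_zero ?_
  rw [Complex.integral_rpow_mul_exp_neg_mul_rpow one_le_two (by linarith) hb]
  have := Real.Gamma_pos_of_pos (show 0 < (s + 2) / 2 by positivity)
  positivity

lemma norm_pow_mul_siteWeight {a b : ℝ} (ha : 0 ≤ a) (i k : ℕ) (z : ℂ) :
    ‖z‖ ^ k * siteWeight a b i z =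
      ‖z‖ ^ (2 * a + 2 * i + k) * Real.exp (-b * ‖z‖ ^ (2 : ℝ)) := by
  rw [siteWeight, Real.rpow_add_of_nonneg (norm_nonneg z) (by positivity) (by positivity),
    Real.rpow_add_of_nonneg (norm_nonneg z) (by positivity) (by positivity),
    Real.rpow_natCast, Real.rpow_two, ← Real.rpow_natCast _ (2 * i)]
  push_cast
  ring

lemma integrable_norm_pow_mul_siteWeight {a b : ℝ} (ha : 0 ≤ a) (hb : 0 < b) (i k : ℕ) :
    Integrable fun z : ℂ => ‖z‖ ^ k * siteWeight a b i z := by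
  simp_rw [norm_pow_mul_siteWeight ha]
  exact integrable_rpow_mul_exp_neg hb (by positivity)

lemma integral_norm_pow_mul_siteWeight {a b : ℝ} (ha : 0 ≤ a) (hb : 0 < b) (i k : ℕ) :
    ∫ z : ℂ, ‖z‖ ^ (2 * k) * siteWeight a b i z =
      Real.pi * b ^ (-(a + i + k + 1)) * Real.Gamma (a + i + k + 1) := by
  simp_rw [norm_pow_mul_siteWeight ha]
  rw [Complex.integral_rpow_mul_exp_neg_mul_rpow one_le_two
    (by have : (0 : ℝ) ≤ 2 * a + 2 * i + (2 * k : ℕ) := by positivity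
        linarith) hb]
  push_cast
  congr 3 <;> ring

lemma integral_norm_pow_mul_siteWeight_eq {a b : ℝ} (ha : 0 ≤ a) (hb : 0 < b) (i k : ℕ) :
    ∫ z : ℂ, ‖z‖ ^ (2 * k) * siteWeight a b i z =
      (∏ m ∈ Finset.range k, ((a + i + (m + 1)) / b)) * ∫ z : ℂ, siteWeight a b i z := by
  induction k with
  | zero => simp
  | succ k ih =>
    rw [Finset.prod_range_succ, mul_right_comm, ← ih, integral_norm_pow_mul_siteWeight ha hb,
      integral_norm_pow_mul_siteWeight ha hb]
    have h : a + i + (k + 1 : ℕ) + 1 = (a + i + k + 1) + 1 := by push_cast; ring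
    rw [h, Real.Gamma_add_one (by positivity), neg_add _ (1 : ℝ), Real.rpow_add hb,
      Real.rpow_neg_one]
    field_simp
    ring

/-- Off-diagonal *-moments of a rotation invariant weight vanish. -/
lemma integral_monomial_mul_radial_eq_zero {k ℓ : ℕ} (h : k ≠ ℓ) (w : ℝ → ℂ) :
    ∫ z : ℂ, z ^ k * (starRingEnd ℂ) z ^ ℓ * w ‖z‖ = 0 := by
  have hd : ((k : ℝ) - ℓ) ≠ 0 := sub_ne_zero.2 (by exact_mod_cast h)
  let u : Circle := Circle.exp (Real.pi / (k - ℓ))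
  have hu : (u : ℂ) ^ k * (starRingEnd ℂ) (u : ℂ) ^ ℓ = -1 := by
    rw [Circle.coe_exp, ← Complex.exp_conj, ← Complex.exp_nat_mul, ← Complex.exp_nat_mul,
      ← Complex.exp_add, ← Complex.exp_pi_mul_I]
    congr 1
    simp only [map_mul, Complex.conj_ofReal, Complex.conj_I]
    have : ((k : ℂ) - ℓ) ≠ 0 := by exact_mod_cast hd
    push_cast
    field_simp
    ring
  have hr := (rotation u).measurePreserving.integral_comp
    (rotation u).toHomeomorph.measurableEmbedding
    (fun z : ℂ => z ^ k * (starRingEnd ℂ) z ^ ℓ * w ‖z‖)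
  have : ∀ z : ℂ, (rotation u z) ^ k * (starRingEnd ℂ) (rotation u z) ^ ℓ * w ‖rotation u z‖ =
      -1 * (z ^ k * (starRingEnd ℂ) z ^ ℓ * w ‖z‖) := by
    intro z
    rw [LinearIsometryEquiv.norm_map, rotation_apply, map_mul, mul_pow, mul_pow, ← hu]
    ring
  simp_rw [this] at hr
  rw [integral_const_mul] at hr
  linear_combination (-1 / 2 : ℂ) * hr

lemma pow_mul_conj_pow (z : ℂ) (k : ℕ) :
    z ^ k * (starRingEnd ℂ) z ^ k = ((‖z‖ ^ (2 * k) : ℝ) : ℂ) := by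
  rw [← mul_pow, Complex.mul_conj, Complex.normSq_eq_norm_sq, pow_mul]
  push_cast
  rfl

/-- The normalized one-particle *-moments. -/
noncomputable def siteMoment (a b : ℝ) (k ℓ i : ℕ) : ℝ :=
  if k = ℓ then ∏ m ∈ Finset.range k, ((a + i + (m + 1)) / b) else 0

lemma integral_monomial_mul_siteWeight {a b : ℝ} (ha : 0 ≤ a) (hb : 0 < b) (k ℓ i : ℕ) :
    ∫ z : ℂ, z ^ k * (starRingEnd ℂ) z ^ ℓ * (siteWeight a b i z : ℂ) =
      (siteMoment a b k ℓ i : ℂ) * ((∫ z : ℂ, siteWeight a b i z : ℝ) : ℂ) := by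
  rw [siteMoment]
  split_ifs with h
  · subst h
    simp_rw [pow_mul_conj_pow, ← Complex.ofReal_mul]
    rw [integral_complex_ofReal, integral_norm_pow_mul_siteWeight_eq ha hb]
  · rw [Complex.ofReal_zero, zero_mul]
    exact integral_monomial_mul_radial_eq_zero h fun r =>
      ((r ^ (2 * a) * r ^ (2 * i) * Real.exp (-b * r ^ 2) : ℝ) : ℂ)

lemma continuous_siteWeight {a b : ℝ} (ha : 0 ≤ a) (i : ℕ) : Continuous (siteWeight a b i) := by
  unfold siteWeight
  exact ((continuous_norm.rpow_const fun _ => Or.inr (by positivity)).mul (by fun_prop)).mul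
    (by fun_prop)

lemma integrable_monomial_mul_siteWeight {a b : ℝ} (ha : 0 ≤ a) (hb : 0 < b) (k ℓ i : ℕ) :
    Integrable fun z : ℂ => z ^ k * (starRingEnd ℂ) z ^ ℓ * (siteWeight a b i z : ℂ) := by
  refine (integrable_norm_pow_mul_siteWeight ha hb i (k + ℓ)).mono' ?_ ?_
  · have := continuous_siteWeight (b := b) ha i
    exact Continuous.aestronglyMeasurable (by fun_prop)
  · refine Eventually.of_forall fun z => ?_
    have : 0 ≤ siteWeight a b i z := by unfold siteWeight; positivity
    simp [pow_add, abs_of_nonneg this]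

lemma setIntegral_annulus {c : ℝ} (hc : 1 ≤ c) (k : ℕ) :
    ∫ z in {z : ℂ | Real.sqrt (c - 1) < ‖z‖ ∧ ‖z‖ < Real.sqrt c}, ‖z‖ ^ (2 * k) =
      Real.pi * ((c ^ (k + 1) - (c - 1) ^ (k + 1)) / (k + 1)) := by
  have hm : MeasurableSet {z : ℂ | Real.sqrt (c - 1) < ‖z‖ ∧ ‖z‖ < Real.sqrt c} :=
    (measurableSet_lt measurable_const measurable_norm).inter
      (measurableSet_lt measurable_norm measurable_const)
  have hle : Real.sqrt (c - 1) ≤ Real.sqrt c := Real.sqrt_le_sqrt (by linarith)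
  rw [← integral_indicator hm]
  have h := integral_fun_norm_addHaar (volume : Measure ℂ)
    ((Set.Ioo (Real.sqrt (c - 1)) (Real.sqrt c)).indicator fun r : ℝ => r ^ (2 * k))
  rw [Complex.finrank_real_complex] at h
  have hv : (volume : Measure ℂ).real (Metric.ball 0 1) = Real.pi := by
    simp [Measure.real, Complex.volume_ball]
  have hi : ∫ y in Set.Ioi (0 : ℝ), y ^ (2 - 1) •
      (Set.Ioo (Real.sqrt (c - 1)) (Real.sqrt c)).indicator (fun r : ℝ => r ^ (2 * k)) y =
      (c ^ (k + 1) - (c - 1) ^ (k + 1)) / (2 * (k + 1)) := by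
    have e : ∀ y : ℝ, y ^ (2 - 1) •
      (Set.Ioo (Real.sqrt (c - 1)) (Real.sqrt c)).indicator (fun r : ℝ => r ^ (2 * k)) y =
      (Set.Ioo (Real.sqrt (c - 1)) (Real.sqrt c)).indicator (fun r : ℝ => r ^ (2 * k + 1)) y := by
      intro y
      simp only [Set.indicator]
      split_ifs
      · simp [pow_succ, mul_comm]
      · simp
    have hsub : Set.Ioi (0 : ℝ) ∩ Set.Ioo (Real.sqrt (c - 1)) (Real.sqrt c) =
        Set.Ioo (Real.sqrt (c - 1)) (Real.sqrt c) :=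
      Set.inter_eq_right.2 fun y hy => (Real.sqrt_nonneg _).trans_lt hy.1
    simp_rw [e]
    rw [setIntegral_indicator measurableSet_Ioo, hsub, ← integral_Ioc_eq_integral_Ioo,
      ← intervalIntegral.integral_of_le hle, integral_pow]
    have hs (x : ℝ) (hx : 0 ≤ x) : Real.sqrt x ^ (2 * k + 1 + 1) = x ^ (k + 1) := by
      rw [show 2 * k + 1 + 1 = 2 * (k + 1) by ring, pow_mul, Real.sq_sqrt hx]
    rw [hs _ (by linarith), hs _ (by linarith)]
    push_cast
    congr 1
    ring
  rw [hi, hv] at h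
  rw [← integral_congr_ae (Eventually.of_forall fun z : ℂ => ?_)]
  · rw [h]
    simp
    field_simp
  · simp [Set.indicator]

lemma volume_annulus {c : ℝ} (hc : 1 ≤ c) :
    volume {z : ℂ | Real.sqrt (c - 1) < ‖z‖ ∧ ‖z‖ < Real.sqrt c} = ENNReal.ofReal Real.pi := by
  have h := setIntegral_annulus hc 0
  simp only [mul_zero, pow_zero, setIntegral_const, smul_eq_mul, mul_one, zero_add, pow_one,
    Nat.cast_zero, div_one, sub_sub_cancel] at h
  have hfin : volume {z : ℂ | Real.sqrt (c - 1) < ‖z‖ ∧ ‖z‖ < Real.sqrt c} ≠ ⊤ := by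
    refine ((measure_mono fun z hz => ?_).trans_lt
      (measure_ball_lt_top (x := (0 : ℂ)) (r := Real.sqrt c))).ne
    simpa using hz.2
  rw [← h, ofReal_measureReal hfin]

lemma isProbabilityMeasure_annulusUniform {c : ℝ} (hc : 1 ≤ c) :
    IsProbabilityMeasure (annulusUniform c) := by
  refine ⟨?_⟩
  rw [annulusUniform, Measure.smul_apply, Measure.restrict_apply_univ, volume_annulus hc,
    smul_eq_mul, ENNReal.inv_mul_cancel (by simp [Real.pi_pos]) ENNReal.ofReal_ne_top]

lemma ae_annulusUniform (c : ℝ) : ∀ᵐ z ∂annulusUniform c, ‖z‖ ≤ Real.sqrt c := by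
  refine Measure.ae_smul_measure ?_ _
  refine ae_restrict_of_forall_mem ?_ fun z hz => hz.2.le
  exact (measurableSet_lt measurable_const measurable_norm).inter
    (measurableSet_lt measurable_norm measurable_const)

lemma integral_monomial_annulusUniform {c : ℝ} (hc : 1 ≤ c) (k ℓ : ℕ) :
    ∫ z, z ^ k * (starRingEnd ℂ) z ^ ℓ ∂annulusUniform c =
      ((if k = ℓ then (c ^ (k + 1) - (c - 1) ^ (k + 1)) / (k + 1) else 0 : ℝ) : ℂ) := by
  have hm : MeasurableSet {z : ℂ | Real.sqrt (c - 1) < ‖z‖ ∧ ‖z‖ < Real.sqrt c} :=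
    (measurableSet_lt measurable_const measurable_norm).inter
      (measurableSet_lt measurable_norm measurable_const)
  rw [annulusUniform, integral_smul_measure, volume_annulus hc]
  split_ifs with h
  · subst h
    simp_rw [pow_mul_conj_pow]
    rw [integral_complex_ofReal, setIntegral_annulus hc, ENNReal.toReal_inv,
      ENNReal.toReal_ofReal Real.pi_pos.le, Complex.real_smul, ← Complex.ofReal_mul,
      inv_mul_cancel_left₀ Real.pi_ne_zero]
  · rw [← integral_indicator hm]
    have := integral_monomial_mul_radial_eq_zero h
      ((Set.Ioo (Real.sqrt (c - 1)) (Real.sqrt c)).indicator 1)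
    rw [integral_congr_ae (Eventually.of_forall fun z : ℂ => ?_), this, smul_zero,
      Complex.ofReal_zero]
    simp [Set.indicator]

/-- The normalized Haar measure on the circle, parametrized by the angle. -/
noncomputable def circleHaar : Measure ℝ :=
  (volume (Set.Ico (0 : ℝ) (2 * Real.pi)))⁻¹ • volume.restrict (Set.Ico 0 (2 * Real.pi))

instance : IsProbabilityMeasure circleHaar := by
  refine ⟨?_⟩
  rw [circleHaar, Measure.smul_apply, Measure.restrict_apply_univ, smul_eq_mul,
    ENNReal.inv_mul_cancel]
  · simp [Real.pi_pos]
  · rw [Real.volume_Ico]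
    exact ENNReal.ofReal_ne_top

lemma torusHaar_eq (p : ℕ) : torusHaar p = Measure.pi fun _ => circleHaar := rfl

instance (p : ℕ) : IsProbabilityMeasure (torusHaar p) := by
  rw [torusHaar_eq]; infer_instance

lemma integral_circleHaar_exp (k : ℤ) :
    ∫ θ, Complex.exp (k * (Complex.I * θ)) ∂circleHaar = if k = 0 then 1 else 0 := by
  split_ifs with h
  · simp [h]
  · rw [circleHaar, integral_smul_measure, ← integral_Icc_eq_integral_Ico,
      integral_Icc_eq_integral_Ioc,
      ← intervalIntegral.integral_of_le Real.two_pi_pos.le]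
    have hk : (k * Complex.I : ℂ) ≠ 0 := by simp [h]
    have := integral_exp_mul_complex (a := 0) (b := 2 * Real.pi) hk
    simp_rw [← mul_assoc]
    rw [this]
    have h2 : Complex.exp (k * Complex.I * ((2 * Real.pi : ℝ) : ℂ)) = 1 := by
      rw [← Complex.exp_int_mul_two_pi_mul_I k]
      push_cast
      ring_nf
    rw [h2]
    simp

/-- The squared Vandermonde determinant, expanded over pairs of permutations. -/
lemma prod_norm_sub_sq_eq {n : ℕ} (z : Fin n → ℂ) :
    ((∏ i, ∏ j ∈ Finset.Ioi i, ‖z i - z j‖ ^ 2 : ℝ) : ℂ) =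
      ∑ σ : Equiv.Perm (Fin n), ∑ τ : Equiv.Perm (Fin n),
        ((Equiv.Perm.sign σ : ℤ) : ℂ) * ((Equiv.Perm.sign τ : ℤ) : ℂ) *
          ∏ i, (z i ^ (σ i : ℕ) * (starRingEnd ℂ) (z i) ^ (τ i : ℕ)) := by
  have h1 : ((∏ i, ∏ j ∈ Finset.Ioi i, ‖z i - z j‖ ^ 2 : ℝ) : ℂ) =
      (Matrix.vandermonde z).det * (starRingEnd ℂ) (Matrix.vandermonde z).det := by
    rw [Matrix.det_vandermonde, map_prod, ← Finset.prod_mul_distrib, Complex.ofReal_prod]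
    refine Finset.prod_congr rfl fun i _ => ?_
    rw [map_prod, ← Finset.prod_mul_distrib, Complex.ofReal_prod]
    refine Finset.prod_congr rfl fun j _ => ?_
    rw [Complex.mul_conj, Complex.normSq_eq_norm_sq, norm_sub_rev]
  rw [h1, ← Matrix.det_transpose, Matrix.det_apply', map_sum, Finset.sum_mul_sum]
  refine Finset.sum_congr rfl fun σ _ => Finset.sum_congr rfl fun τ _ => ?_
  simp only [Matrix.transpose_apply, Matrix.vandermonde_apply, map_mul, map_prod, map_pow,
    map_intCast, Finset.prod_mul_distrib]
  ring

/-- Averaging the squared Vandermonde determinant over the torus leaves the permanent-type sum. -/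
lemma integral_torusHaar_vandermonde {n : ℕ} (z : Fin n → ℂ) :
    ∫ θ : Fin n → ℝ, (∏ i, ∏ j ∈ Finset.Ioi i,
        ‖Complex.exp (-(Complex.I * θ i)) * z i - Complex.exp (-(Complex.I * θ j)) * z j‖ ^ 2)
          ∂torusHaar n =
      ∑ π : Equiv.Perm (Fin n), ∏ i, ‖z i‖ ^ (2 * (π i : ℕ)) := by
  have hterm (σ τ : Equiv.Perm (Fin n)) (θ : Fin n → ℝ) :
      ∏ i, ((Complex.exp (-(Complex.I * θ i)) * z i) ^ (σ i : ℕ) *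
        (starRingEnd ℂ) (Complex.exp (-(Complex.I * θ i)) * z i) ^ (τ i : ℕ)) =
      (∏ i, (z i ^ (σ i : ℕ) * (starRingEnd ℂ) (z i) ^ (τ i : ℕ))) *
        ∏ i, Complex.exp ((((τ i : ℕ) : ℤ) - ((σ i : ℕ) : ℤ) : ℤ) * (Complex.I * θ i)) := by
    rw [← Finset.prod_mul_distrib]
    refine Finset.prod_congr rfl fun i _ => ?_
    have : Complex.exp ((((τ i : ℕ) : ℤ) - ((σ i : ℕ) : ℤ) : ℤ) * (Complex.I * θ i)) =
        Complex.exp (-(Complex.I * θ i)) ^ (σ i : ℕ) *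
          (starRingEnd ℂ) (Complex.exp (-(Complex.I * θ i))) ^ (τ i : ℕ) := by
      rw [← Complex.exp_conj, ← Complex.exp_nat_mul, ← Complex.exp_nat_mul, ← Complex.exp_add]
      congr 1
      simp
      ring
    rw [this, map_mul, mul_pow, mul_pow]
    ring
  have hint (σ τ : Equiv.Perm (Fin n)) :
      ∫ θ : Fin n → ℝ, ∏ i, Complex.exp ((((τ i : ℕ) : ℤ) - ((σ i : ℕ) : ℤ) : ℤ) *
        (Complex.I * θ i)) ∂torusHaar n = if σ = τ then 1 else 0 := by
    rw [torusHaar_eq, integral_fintype_prod_eq_prod (fun i (θ : ℝ) =>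
      Complex.exp ((((τ i : ℕ) : ℤ) - ((σ i : ℕ) : ℤ) : ℤ) * (Complex.I * θ)))]
    simp_rw [integral_circleHaar_exp]
    split_ifs with h
    · simp [h]
    · obtain ⟨i, hi⟩ : ∃ i, σ i ≠ τ i := by
        by_contra! h'
        exact h (Equiv.ext h')
      refine Finset.prod_eq_zero (Finset.mem_univ i) (if_neg ?_)
      intro h'
      exact hi (Fin.ext (by omega))
  have hintegrable (σ τ : Equiv.Perm (Fin n)) : Integrable (fun θ : Fin n → ℝ =>
      ∏ i, Complex.exp ((((τ i : ℕ) : ℤ) - ((σ i : ℕ) : ℤ) : ℤ) * (Complex.I * θ i)))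
        (torusHaar n) := by
    refine Integrable.of_bound (Continuous.aestronglyMeasurable (by fun_prop)) 1
      (Eventually.of_forall fun θ => ?_)
    rw [norm_prod]
    refine (Finset.prod_eq_one fun i _ => ?_).le
    rw [← Complex.norm_exp_ofReal_mul_I ((((τ i : ℕ) : ℤ) - ((σ i : ℕ) : ℤ) : ℤ) * θ i)]
    congr 2
    push_cast
    ring
  have hC : ((∫ θ : Fin n → ℝ, (∏ i, ∏ j ∈ Finset.Ioi i,
      ‖Complex.exp (-(Complex.I * θ i)) * z i - Complex.exp (-(Complex.I * θ j)) * z j‖ ^ 2)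
        ∂torusHaar n : ℝ) : ℂ) =
      ((∑ π : Equiv.Perm (Fin n), ∏ i, ‖z i‖ ^ (2 * (π i : ℕ)) : ℝ) : ℂ) := by
    rw [← integral_complex_ofReal]
    have e (θ : Fin n → ℝ) := prod_norm_sub_sq_eq fun i => Complex.exp (-(Complex.I * θ i)) * z i
    simp_rw [e, hterm]
    rw [integral_finsetSum _ fun σ _ => integrable_finsetSum _ fun τ _ =>
      ((hintegrable σ τ).const_mul _).const_mul _, Complex.ofReal_sum]
    refine Finset.sum_congr rfl fun σ _ => ?_
    rw [integral_finsetSum _ fun τ _ => ((hintegrable σ τ).const_mul _).const_mul _]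
    simp_rw [integral_const_mul, hint]
    rw [Finset.sum_eq_single σ (fun τ _ h => by rw [if_neg (Ne.symm h)]; simp) (by simp)]
    have hs : ((Equiv.Perm.sign σ : ℤ) : ℂ) * ((Equiv.Perm.sign σ : ℤ) : ℂ) = 1 := by
      rcases Int.units_eq_one_or (Equiv.Perm.sign σ) with h | h <;> simp [h]
    rw [hs, if_pos rfl, one_mul, mul_one, Complex.ofReal_prod]
    refine Finset.prod_congr rfl fun i _ => ?_
    rw [← mul_pow, Complex.mul_conj, Complex.normSq_eq_norm_sq, pow_mul]
    push_cast
    rfl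
  exact_mod_cast hC

lemma measurable_torusAction (p : ℕ) : Measurable (fun q : (Fin p → ℝ) × (Fin p → ℂ) =>
    fun j => Complex.exp (Complex.I * (q.1 j : ℂ)) * q.2 j) := by
  fun_prop

/-- Torus averaging commutes with marginals. -/
lemma map_torusAverage {p n : ℕ} (h : p ≤ n) (μ : Measure (Fin n → ℂ)) [SFinite μ] :
    Measure.map (fun (y : Fin n → ℂ) (j : Fin p) => y (Fin.castLE h j)) (torusAverage n μ) =
      torusAverage p (Measure.map (fun (y : Fin n → ℂ) (j : Fin p) => y (Fin.castLE h j)) μ) := by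
  have hproj : Measure.map (fun (y : Fin n → ℝ) (j : Fin p) => y (Fin.castLE h j)) (torusHaar n) =
      torusHaar p := by
    rw [torusHaar_eq, torusHaar_eq]
    refine (Measure.pi_eq fun s hs => ?_).symm
    rw [Measure.map_apply (by fun_prop) (.univ_pi hs)]
    have : (fun (y : Fin n → ℝ) (j : Fin p) => y (Fin.castLE h j)) ⁻¹' Set.univ.pi s =
        Set.univ.pi (Function.extend (Fin.castLE h) s fun _ => Set.univ) := by
      ext y
      simp only [Set.mem_preimage, Set.mem_univ_pi]
      refine ⟨fun hy i => ?_, fun hy j => ?_⟩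
      · by_cases hi : ∃ j, Fin.castLE h j = i
        · obtain ⟨j, rfl⟩ := hi
          rw [(Fin.castLE_injective h).extend_apply]
          exact hy j
        · rw [Function.extend_apply' _ _ _ hi]
          trivial
      · have := hy (Fin.castLE h j)
        rwa [(Fin.castLE_injective h).extend_apply] at this
    rw [this, Measure.pi_pi]
    refine (Fintype.prod_of_injective _ (Fin.castLE_injective h) _ _ (fun i hi => ?_)
      fun j => ?_).symm
    · rw [Function.extend_apply' _ _ _ hi, measure_univ]
    · rw [(Fin.castLE_injective h).extend_apply]
  rw [torusAverage, torusAverage, ← hproj, Measure.map_prod_map _ _ (by fun_prop) (by fun_prop),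
    Measure.map_map (by fun_prop) (measurable_torusAction n),
    Measure.map_map (measurable_torusAction p) (by fun_prop)]
  rfl

lemma measurePreserving_rotate {n : ℕ} (θ : Fin n → ℝ) :
    MeasurePreserving (fun (z : Fin n → ℂ) j => Complex.exp (Complex.I * (θ j : ℂ)) * z j) := by
  have h (j : Fin n) :
      MeasurePreserving (fun z : ℂ => Complex.exp (Complex.I * (θ j : ℂ)) * z) := by
    have e : (fun z : ℂ => Complex.exp (Complex.I * (θ j : ℂ)) * z) =
        rotation (Circle.exp (θ j)) := by
      ext z
      simp [rotation_apply, Circle.coe_exp, mul_comm Complex.I]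
    rw [e]
    exact (rotation (Circle.exp (θ j))).measurePreserving
  exact volume_preserving_pi h

/-- The torus average of a measure with density averages the density. -/
lemma torusAverage_withDensity {n : ℕ} {D : (Fin n → ℂ) → ENNReal} (hD : Measurable D)
    [SFinite (volume.withDensity D)] :
    torusAverage n (volume.withDensity D) = volume.withDensity fun z =>
      ∫⁻ θ : Fin n → ℝ, D (fun j => Complex.exp (-(Complex.I * (θ j : ℂ))) * z j)
        ∂torusHaar n := by
  have hD' : Measurable fun q : (Fin n → ℂ) × (Fin n → ℝ) =>
      D (fun j => Complex.exp (-(Complex.I * (q.2 j : ℂ))) * q.1 j) := hD.comp (by fun_prop)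
  refine Measure.ext_of_lintegral _ fun f hf => ?_
  rw [torusAverage, lintegral_map hf (measurable_torusAction n),
    lintegral_prod (fun q : (Fin n → ℝ) × (Fin n → ℂ) =>
      f fun j => Complex.exp (Complex.I * (q.1 j : ℂ)) * q.2 j)
      (hf.comp (measurable_torusAction n)).aemeasurable,
    lintegral_withDensity_eq_lintegral_mul _ hD'.lintegral_prod_right' hf]
  have h1 (θ : Fin n → ℝ) : ∫⁻ z, f (fun j => Complex.exp (Complex.I * (θ j : ℂ)) * z j)
      ∂(volume.withDensity D) =
      ∫⁻ z, D (fun j => Complex.exp (-(Complex.I * (θ j : ℂ))) * z j) * f z := by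
    have hg : Measurable fun z : Fin n → ℂ =>
        D (fun j => Complex.exp (-(Complex.I * (θ j : ℂ))) * z j) * f z :=
      (hD.comp (by fun_prop)).mul hf
    have hfr : Measurable fun z : Fin n → ℂ =>
        f fun j => Complex.exp (Complex.I * (θ j : ℂ)) * z j := hf.comp (by fun_prop)
    rw [lintegral_withDensity_eq_lintegral_mul _ hD hfr,
      ← (measurePreserving_rotate θ).lintegral_comp hg]
    refine lintegral_congr fun z => ?_
    simp only [Pi.mul_apply, ← mul_assoc, ← Complex.exp_add, neg_add_cancel, Complex.exp_zero,
      one_mul]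
  simp_rw [h1]
  rw [lintegral_lintegral_swap]
  · refine lintegral_congr fun z => ?_
    simp only [Pi.mul_apply]
    rw [lintegral_mul_const]
    exact hD.comp (by fun_prop)
  · refine Measurable.aemeasurable ?_
    exact (hD'.comp measurable_swap).mul (hf.comp measurable_snd)

/-- Full-dimensional version of the averaging identity. -/
lemma torusAverage_eq {n : ℕ} {q b K K' : ℝ} (hK : 0 < K) (hK' : 0 < K')
    (μ μ' : Measure (Fin n → ℂ)) [IsProbabilityMeasure μ] [IsProbabilityMeasure μ']
    (hμ : μ = volume.withDensity (fun z : Fin n → ℂ =>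
        ENNReal.ofReal (K * (∏ i, ‖z i‖) ^ q *
          (∏ i, ∏ j ∈ Finset.Ioi i, ‖z i - z j‖ ^ 2) *
          Real.exp (-b * ∑ i, ‖z i‖ ^ 2))))
    (hμ' : μ' = volume.withDensity (fun z : Fin n → ℂ =>
        ENNReal.ofReal (K' * (∏ i, ‖z i‖) ^ q *
          (∑ π : Equiv.Perm (Fin n), ∏ i, ‖z i‖ ^ (2 * ((π i : ℕ)))) *
          Real.exp (-b * ∑ i, ‖z i‖ ^ 2)))) :
    torusAverage n μ = μ' := by
  have hD : Measurable (fun z : Fin n → ℂ =>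
        ENNReal.ofReal (K * (∏ i, ‖z i‖) ^ q *
          (∏ i, ∏ j ∈ Finset.Ioi i, ‖z i - z j‖ ^ 2) *
          Real.exp (-b * ∑ i, ‖z i‖ ^ 2))) := by fun_prop
  have hD' : Measurable (fun z : Fin n → ℂ =>
        ENNReal.ofReal (K' * (∏ i, ‖z i‖) ^ q *
          (∑ π : Equiv.Perm (Fin n), ∏ i, ‖z i‖ ^ (2 * ((π i : ℕ)))) *
          Real.exp (-b * ∑ i, ‖z i‖ ^ 2))) := by fun_prop
  have hprob : IsProbabilityMeasure (torusAverage n μ) :=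
    Measure.isProbabilityMeasure_map (measurable_torusAction n).aemeasurable
  have hsmul : torusAverage n μ = ENNReal.ofReal (K / K') • μ' := by
    have : SFinite (volume.withDensity (fun z : Fin n → ℂ =>
        ENNReal.ofReal (K * (∏ i, ‖z i‖) ^ q *
          (∏ i, ∏ j ∈ Finset.Ioi i, ‖z i - z j‖ ^ 2) *
          Real.exp (-b * ∑ i, ‖z i‖ ^ 2)))) := hμ ▸ inferInstance
    rw [hμ, torusAverage_withDensity hD, hμ', ← withDensity_smul _ hD']
    congr 1
    ext z
    have hn (θ : Fin n → ℝ) (i) : ‖Complex.exp (-(Complex.I * (θ i : ℂ))) * z i‖ = ‖z i‖ := by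
      rw [norm_mul, Complex.norm_exp]; simp
    simp_rw [hn]
    rw [← ofReal_integral_eq_lintegral_ofReal]
    · rw [integral_mul_const, integral_const_mul, integral_torusHaar_vandermonde, Pi.smul_apply,
        smul_eq_mul, ← ENNReal.ofReal_mul (by positivity)]
      congr 1
      field_simp
    · have hc : Continuous fun θ : Fin n → ℝ => ∏ i, ∏ j ∈ Finset.Ioi i,
          ‖Complex.exp (-(Complex.I * (θ i : ℂ))) * z i -
            Complex.exp (-(Complex.I * (θ j : ℂ))) * z j‖ ^ 2 := by fun_prop
      refine ((Integrable.of_bound (C := ∏ i, ∏ j ∈ Finset.Ioi i, (‖z i‖ + ‖z j‖) ^ 2)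
        hc.aestronglyMeasurable (Eventually.of_forall fun θ => ?_)).const_mul _).mul_const _
      rw [Real.norm_of_nonneg (by positivity)]
      gcongr with i _ j _
      refine (norm_sub_le _ _).trans ?_
      rw [hn, hn]
    · exact Eventually.of_forall fun θ => by positivity
  have h1 : ENNReal.ofReal (K / K') = 1 := by
    have := congrArg (fun m => m Set.univ) hsmul
    simpa using this.symm
  rw [hsmul, h1, one_smul]

lemma permanentDensity_eq {n : ℕ} (a b K : ℝ) (z : Fin n → ℂ) :
    K * (∏ i, ‖z i‖) ^ (2 * a) * (∑ π : Equiv.Perm (Fin n), ∏ i, ‖z i‖ ^ (2 * (π i : ℕ))) *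
        Real.exp (-b * ∑ i, ‖z i‖ ^ 2) =
      K * ∑ π : Equiv.Perm (Fin n), ∏ i, siteWeight a b (π i) (z i) := by
  rw [← Real.finsetProd_rpow _ _ fun i _ => norm_nonneg _, Finset.mul_sum Finset.univ _ (-b),
    Real.exp_sum]
  simp only [siteWeight, Finset.prod_mul_distrib, ← Finset.mul_sum, ← Finset.sum_mul]
  ring

/-- The *-moments of the measure with permanent-type density are averages over permutations. -/
lemma integral_monomial_permanent {n : ℕ} {a b K : ℝ} (ha : 0 ≤ a) (hb : 0 < b) (hK : 0 < K)
    (μ : Measure (Fin n → ℂ)) [IsProbabilityMeasure μ]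
    (hμ : μ = volume.withDensity (fun z : Fin n → ℂ => ENNReal.ofReal
      (K * ∑ π : Equiv.Perm (Fin n), ∏ i, siteWeight a b (π i) (z i)))) (k ℓ : Fin n → ℕ) :
    Integrable (fun z => ∏ i, z i ^ k i * (starRingEnd ℂ) (z i) ^ ℓ i) μ ∧
      ∫ z, ∏ i, z i ^ k i * (starRingEnd ℂ) (z i) ^ ℓ i ∂μ =
        (((n.factorial : ℝ)⁻¹ * ∑ π : Equiv.Perm (Fin n),
          ∏ i, siteMoment a b (k i) (ℓ i) (π i) : ℝ) : ℂ) := by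
  have hw (i : ℕ) (z : ℂ) : 0 ≤ siteWeight a b i z := by unfold siteWeight; positivity
  have hD0 (z : Fin n → ℂ) : 0 ≤ K * ∑ π : Equiv.Perm (Fin n), ∏ i, siteWeight a b (π i) (z i) :=
    mul_nonneg hK.le (Finset.sum_nonneg fun π _ => Finset.prod_nonneg fun i _ => hw _ _)
  have hDm : Measurable fun z : Fin n → ℂ => ENNReal.ofReal
      (K * ∑ π : Equiv.Perm (Fin n), ∏ i, siteWeight a b (π i) (z i)) := by
    have h (i : ℕ) : Measurable (siteWeight a b i) := (continuous_siteWeight ha i).measurable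
    fun_prop
  set Z : ℝ := ∏ i : Fin n, ∫ z : ℂ, siteWeight a b i z with hZ
  have hexp (k ℓ : Fin n → ℕ) (z : Fin n → ℂ) :
      (ENNReal.ofReal (K * ∑ π : Equiv.Perm (Fin n),
        ∏ i, siteWeight a b (π i) (z i))).toReal • ∏ i, z i ^ k i * (starRingEnd ℂ) (z i) ^ ℓ i =
      (K : ℂ) * ∑ π : Equiv.Perm (Fin n), ∏ i, (z i ^ k i * (starRingEnd ℂ) (z i) ^ ℓ i *
        (siteWeight a b (π i) (z i) : ℂ)) := by
    rw [ENNReal.toReal_ofReal (hD0 z), Complex.real_smul]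
    push_cast
    simp only [Finset.prod_mul_distrib]
    rw [← Finset.mul_sum]
    ring
  have hint (k ℓ : Fin n → ℕ) (π : Equiv.Perm (Fin n)) :
      Integrable fun z : Fin n → ℂ => ∏ i, (z i ^ k i * (starRingEnd ℂ) (z i) ^ ℓ i *
        (siteWeight a b (π i) (z i) : ℂ)) :=
    Integrable.fintype_prod fun i => integrable_monomial_mul_siteWeight ha hb (k i) (ℓ i) (π i)
  have hval (k ℓ : Fin n → ℕ) : ∫ z, ∏ i, z i ^ k i * (starRingEnd ℂ) (z i) ^ ℓ i ∂μ =
      ((K * (Z * ∑ π : Equiv.Perm (Fin n), ∏ i, siteMoment a b (k i) (ℓ i) (π i)) : ℝ) : ℂ) := by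
    rw [hμ, integral_withDensity_eq_integral_toReal_smul hDm
      (Eventually.of_forall fun _ => ENNReal.ofReal_lt_top)]
    simp_rw [hexp]
    rw [integral_const_mul, integral_finsetSum _ fun π _ => hint k ℓ π, Complex.ofReal_mul,
      Complex.ofReal_mul, Complex.ofReal_sum, Finset.mul_sum Finset.univ _ (Z : ℂ)]
    congr 1
    refine Finset.sum_congr rfl fun π _ => ?_
    rw [integral_fintype_prod_volume_eq_prod (fun i (x : ℂ) => x ^ k i * (starRingEnd ℂ) x ^ ℓ i *
        (siteWeight a b (π i) x : ℂ))]
    simp_rw [integral_monomial_mul_siteWeight ha hb]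
    rw [Finset.prod_mul_distrib, mul_comm, ← Complex.ofReal_prod, ← Complex.ofReal_prod, hZ,
      Equiv.prod_comp π fun i : Fin n => ∫ z : ℂ, siteWeight a b (i : ℕ) z]
  refine ⟨?_, ?_⟩
  · rw [hμ, integrable_withDensity_iff_integrable_smul' hDm
      (Eventually.of_forall fun _ => ENNReal.ofReal_lt_top)]
    simp_rw [hexp]
    exact (integrable_finsetSum _ fun π _ => hint k ℓ π).const_mul _
  · have h0 := hval 0 0
    have hKZ : K * Z = (n.factorial : ℝ)⁻¹ := by
      simp [siteMoment, Fintype.card_perm] at h0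
      have h1 : K * (Z * n.factorial) = 1 := by exact_mod_cast h0.symm
      have : (n.factorial : ℝ) ≠ 0 := by positivity
      field_simp
      linarith
    rw [hval, ← mul_assoc, hKZ]

/-- Joint *-moments of the first `p` coordinates. -/
lemma integral_monomial_marginal {p n : ℕ} (h : p ≤ n) {a b K : ℝ} (ha : 0 ≤ a) (hb : 0 < b)
    (hK : 0 < K) (μ : Measure (Fin n → ℂ)) [IsProbabilityMeasure μ]
    (hμ : μ = volume.withDensity (fun z : Fin n → ℂ => ENNReal.ofReal
      (K * ∑ π : Equiv.Perm (Fin n), ∏ i, siteWeight a b (π i) (z i)))) (k ℓ : Fin p → ℕ) :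
    Integrable (fun x => ∏ j, x j ^ k j * (starRingEnd ℂ) (x j) ^ ℓ j)
        (Measure.map (fun (y : Fin n → ℂ) (j : Fin p) => y (Fin.castLE h j)) μ) ∧
      ∫ x, ∏ j, x j ^ k j * (starRingEnd ℂ) (x j) ^ ℓ j
          ∂(Measure.map (fun (y : Fin n → ℂ) (j : Fin p) => y (Fin.castLE h j)) μ) =
        (((n.factorial : ℝ)⁻¹ * ∑ π : Equiv.Perm (Fin n),
          ∏ j, siteMoment a b (k j) (ℓ j) (π (Fin.castLE h j)) : ℝ) : ℂ) := by
  have hinj := Fin.castLE_injective h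
  have hproj : Measurable fun (y : Fin n → ℂ) (j : Fin p) => y (Fin.castLE h j) := by fun_prop
  have hm : Continuous fun x : Fin p → ℂ => ∏ j, x j ^ k j * (starRingEnd ℂ) (x j) ^ ℓ j := by
    fun_prop
  have hmono (y : Fin n → ℂ) :
      ∏ j, y (Fin.castLE h j) ^ k j * (starRingEnd ℂ) (y (Fin.castLE h j)) ^ ℓ j =
      ∏ i, y i ^ Function.extend (Fin.castLE h) k 0 i *
        (starRingEnd ℂ) (y i) ^ Function.extend (Fin.castLE h) ℓ 0 i := by
    refine Fintype.prod_of_injective _ hinj _ _ (fun i hi => ?_) fun j => ?_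
    · rw [Function.extend_apply' _ _ _ hi, Function.extend_apply' _ _ _ hi]
      simp
    · rw [hinj.extend_apply, hinj.extend_apply]
  have hsite (π : Equiv.Perm (Fin n)) :
      ∏ j, siteMoment a b (k j) (ℓ j) (π (Fin.castLE h j)) =
      ∏ i, siteMoment a b (Function.extend (Fin.castLE h) k 0 i)
        (Function.extend (Fin.castLE h) ℓ 0 i) (π i) := by
    refine Fintype.prod_of_injective _ hinj _ _ (fun i hi => ?_) fun j => ?_
    · rw [Function.extend_apply' _ _ _ hi, Function.extend_apply' _ _ _ hi]
      simp [siteMoment]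
    · rw [hinj.extend_apply, hinj.extend_apply]
  obtain ⟨h1, h2⟩ := integral_monomial_permanent ha hb hK μ hμ
    (Function.extend (Fin.castLE h) k 0) (Function.extend (Fin.castLE h) ℓ 0)
  rw [integrable_map_measure hm.aestronglyMeasurable hproj.aemeasurable,
    integral_map hproj.aemeasurable hm.aestronglyMeasurable]
  simp_rw [hmono, hsite]
  refine ⟨?_, h2⟩
  simpa only [Function.comp_def, hmono] using h1

lemma abs_siteMoment_le {c : ℝ} (hc : 1 ≤ c) (n : ℕ) (i : Fin n) (k ℓ : ℕ) :
    |siteMoment ((c - 1) * n) n k ℓ i| ≤ (c + k) ^ k := by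
  rw [siteMoment]
  split_ifs with h
  · have hn : (0 : ℝ) < n := by exact_mod_cast i.pos
    have hi : (i : ℝ) ≤ n := by exact_mod_cast i.is_lt.le
    have hn1 : (1 : ℝ) ≤ n := by exact_mod_cast i.pos
    have hfac (m : ℕ) (hm : m ∈ Finset.range k) :
        |((c - 1) * n + i + (m + 1)) / n| ≤ c + k := by
      have hmk : (m : ℝ) + 1 ≤ k := by exact_mod_cast Finset.mem_range.1 hm
      have hc' : 0 ≤ c - 1 := by linarith
      rw [abs_of_nonneg (by positivity), div_le_iff₀ hn]
      nlinarith [mul_nonneg (Nat.cast_nonneg (α := ℝ) k) (sub_nonneg.2 hn1)]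
    rw [Finset.abs_prod]
    simpa using Finset.prod_le_prod (fun m _ => abs_nonneg _) hfac
  · rw [abs_zero]
    positivity

/-- Limit of the joint *-moments. -/
lemma tendsto_perm_siteMoment {c : ℝ} (hc : 1 ≤ c) {p : ℕ} (k ℓ : Fin p → ℕ) :
    Tendsto (fun n : ℕ => if h : p ≤ n then
        (((n.factorial : ℝ)⁻¹ * ∑ π : Equiv.Perm (Fin n),
          ∏ j, siteMoment ((c - 1) * n) n (k j) (ℓ j) (π (Fin.castLE h j)) : ℝ) : ℂ) else 0)
      atTop (nhds (∫ x, (∏ j, x j ^ k j * (starRingEnd ℂ) (x j) ^ ℓ j)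
            ∂(Measure.pi (fun _ : Fin p => annulusUniform c)))) := by
  have := isProbabilityMeasure_annulusUniform hc
  rw [integral_fintype_prod_eq_prod (fun j (x : ℂ) => x ^ k j * (starRingEnd ℂ) x ^ ℓ j)]
  simp_rw [integral_monomial_annulusUniform hc]
  rw [← Complex.ofReal_prod]
  have hlim (j : Fin p) : Tendsto (fun n : ℕ => (n : ℝ)⁻¹ * ∑ i : Fin n,
      siteMoment ((c - 1) * n) n (k j) (ℓ j) i) atTop
      (nhds (if k j = ℓ j then (c ^ (k j + 1) - (c - 1) ^ (k j + 1)) / (k j + 1) else 0)) := by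
    unfold siteMoment
    split_ifs
    · exact tendsto_average_moment c (k j)
    · simp
  have hbound (n : ℕ) (j : Fin p) (i : Fin n) :
      |siteMoment ((c - 1) * n) n (k j) (ℓ j) i| ≤ ∑ j, (c + k j) ^ k j :=
    (abs_siteMoment_le hc n i (k j) (ℓ j)).trans
      (Finset.single_le_sum (f := fun j => (c + k j) ^ k j) (fun j _ => by positivity)
        (Finset.mem_univ j))
  refine ((Complex.continuous_ofReal.tendsto _).comp
    (tendsto_perm_average _ hbound _ hlim)).congr fun n => ?_
  simp only [Function.comp_apply]
  split_ifs
  · rfl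
  · simp

lemma ae_pi_annulusUniform {c : ℝ} (hc : 1 ≤ c) (p : ℕ) :
    ∀ᵐ x ∂(Measure.pi fun _ : Fin p => annulusUniform c), ‖x‖ ≤ Real.sqrt c := by
  have := isProbabilityMeasure_annulusUniform hc
  have h (j : Fin p) : ∀ᵐ x ∂(Measure.pi fun _ : Fin p => annulusUniform c),
      ‖x j‖ ≤ Real.sqrt c :=
    (Measure.tendsto_eval_ae_ae (μ := fun _ : Fin p => annulusUniform c) (i := j)).eventually
      (ae_annulusUniform c)
  filter_upwards [ae_all_iff.2 h] with x hx
  exact (pi_norm_le_iff_of_nonneg (Real.sqrt_nonneg c)).2 hx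

/-- with `μ n` the measure on `ℂⁿ` with density proportional to
`(∏|zᵢ|)^{2(c-1)n} ∏_{i<j}|zᵢ-zⱼ|² exp(-n Σ|zᵢ|²)` and `μ' n` the measure with density
proportional to `(∏|zᵢ|)^{2(c-1)n} (Σ_{π∈S_n} ∏ |zᵢ|^{2(π(i)-1)}) exp(-n Σ|zᵢ|²)`, the
`p`-th marginal of `μ' n` is the average of the `p`-th marginal of `μ n` over the action of
the `p`-torus by coordinatewise multiplication; consequently the `p`-th marginals of `μ' n`
converge, in *-moments and weak*, to the product of uniform distributions on the annulus
`√(c-1) < |z| < √c`. -/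
theorem stmt_13 (c : ℝ) (hc : 1 ≤ c) (μ μ' : ∀ n : ℕ, Measure (Fin n → ℂ))
    [∀ n, IsProbabilityMeasure (μ n)] [∀ n, IsProbabilityMeasure (μ' n)]
    (hμ : ∀ n : ℕ, 1 ≤ n → ∃ K : ℝ, 0 < K ∧
      μ n = volume.withDensity (fun z : Fin n → ℂ =>
        ENNReal.ofReal (K * (∏ i, ‖z i‖) ^ (2 * (c - 1) * (n : ℝ)) *
          (∏ i, ∏ j ∈ Finset.Ioi i, ‖z i - z j‖ ^ 2) *
          Real.exp (-(n : ℝ) * ∑ i, ‖z i‖ ^ 2))))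
    (hμ' : ∀ n : ℕ, 1 ≤ n → ∃ K' : ℝ, 0 < K' ∧
      μ' n = volume.withDensity (fun z : Fin n → ℂ =>
        ENNReal.ofReal (K' * (∏ i, ‖z i‖) ^ (2 * (c - 1) * (n : ℝ)) *
          (∑ π : Equiv.Perm (Fin n), ∏ i, ‖z i‖ ^ (2 * ((π i : ℕ)))) *
          Real.exp (-(n : ℝ) * ∑ i, ‖z i‖ ^ 2)))) :
    ∀ p : ℕ,
      (∀ n : ℕ, ∀ h : p ≤ n, 1 ≤ n →
        Measure.map (fun (y : Fin n → ℂ) (j : Fin p) => y (Fin.castLE h j)) (μ' n) =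
          torusAverage p
            (Measure.map (fun (y : Fin n → ℂ) (j : Fin p) => y (Fin.castLE h j)) (μ n))) ∧
      (∀ f : ZeroAtInftyContinuousMap (Fin p → ℂ) ℝ,
        Tendsto (fun n : ℕ =>
            if h : p ≤ n then
              ∫ x, f x ∂(Measure.map (fun (y : Fin n → ℂ) (j : Fin p) => y (Fin.castLE h j)) (μ' n))
            else 0)
          atTop (nhds (∫ x, f x ∂(Measure.pi (fun _ : Fin p => annulusUniform c))))) ∧
      (∀ k ℓ : Fin p → ℕ,
        Tendsto (fun n : ℕ =>
            if h : p ≤ n then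
              ∫ x, (∏ j, x j ^ k j * (starRingEnd ℂ) (x j) ^ ℓ j)
                ∂(Measure.map (fun (y : Fin n → ℂ) (j : Fin p) => y (Fin.castLE h j)) (μ' n))
            else 0)
          atTop (nhds (∫ x, (∏ j, x j ^ k j * (starRingEnd ℂ) (x j) ^ ℓ j)
            ∂(Measure.pi (fun _ : Fin p => annulusUniform c))))) := by
  intro p
  have := isProbabilityMeasure_annulusUniform hc
  have hmarg (n : ℕ) (h : p ≤ n) (hn : 1 ≤ n) (k ℓ : Fin p → ℕ) :
      Integrable (fun x => ∏ j, x j ^ k j * (starRingEnd ℂ) (x j) ^ ℓ j)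
        (Measure.map (fun (y : Fin n → ℂ) (j : Fin p) => y (Fin.castLE h j)) (μ' n)) ∧
      ∫ x, ∏ j, x j ^ k j * (starRingEnd ℂ) (x j) ^ ℓ j
          ∂(Measure.map (fun (y : Fin n → ℂ) (j : Fin p) => y (Fin.castLE h j)) (μ' n)) =
        (((n.factorial : ℝ)⁻¹ * ∑ π : Equiv.Perm (Fin n),
          ∏ j, siteMoment ((c - 1) * n) n (k j) (ℓ j) (π (Fin.castLE h j)) : ℝ) : ℂ) := by
    obtain ⟨K', hK', hd⟩ := hμ' n hn
    have hc' : 0 ≤ c - 1 := by linarith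
    refine integral_monomial_marginal h (by positivity) (by exact_mod_cast hn) hK' (μ' n) ?_ k ℓ
    simp_rw [mul_assoc 2 (c - 1) (n : ℝ), permanentDensity_eq] at hd
    exact hd
  have hmom (k ℓ : Fin p → ℕ) : Tendsto (fun n : ℕ =>
      if h : p ≤ n then
        ∫ x, (∏ j, x j ^ k j * (starRingEnd ℂ) (x j) ^ ℓ j)
          ∂(Measure.map (fun (y : Fin n → ℂ) (j : Fin p) => y (Fin.castLE h j)) (μ' n))
      else 0)
      atTop (nhds (∫ x, (∏ j, x j ^ k j * (starRingEnd ℂ) (x j) ^ ℓ j)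
        ∂(Measure.pi (fun _ : Fin p => annulusUniform c)))) := by
    refine (tendsto_perm_siteMoment hc k ℓ).congr' ?_
    filter_upwards [eventually_ge_atTop 1] with n hn
    split_ifs with h
    · exact (hmarg n h hn k ℓ).2.symm
    · rfl
  refine ⟨fun n h hn => ?_, fun f => ?_, hmom⟩
  · obtain ⟨K, hK, hd⟩ := hμ n hn
    obtain ⟨K', hK', hd'⟩ := hμ' n hn
    rw [← map_torusAverage, torusAverage_eq hK hK' (μ n) (μ' n) hd hd']
  · have hle (m : ℕ) : p ≤ m + (p + 1) := by omega
    have hprob (m : ℕ) : IsProbabilityMeasure (Measure.map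
        (fun (y : Fin (m + (p + 1)) → ℂ) (j : Fin p) => y (Fin.castLE (hle m) j))
        (μ' (m + (p + 1)))) :=
      Measure.isProbabilityMeasure_map
        (measurable_pi_lambda _ fun j => measurable_pi_apply (Fin.castLE (hle m) j)).aemeasurable
    rw [← tendsto_add_atTop_iff_nat (p + 1)]
    simp only [dif_pos (hle _)]
    refine tendsto_integral_of_tendsto_moments _ _ (Real.sqrt_nonneg c)
      (ae_pi_annulusUniform hc p) (fun m k ℓ => (hmarg _ (hle m) (by omega) k ℓ).1)
      (fun k ℓ => ?_) (f : C(Fin p → ℂ, ℝ)) (M := ‖f.toBCF‖) fun x => f.toBCF.norm_coe_le_norm x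
    have := (tendsto_add_atTop_iff_nat (p + 1)).2 (hmom k ℓ)
    simpa only [dif_pos (hle _)] using this
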